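/- Let C ⊆ ℝ^n be nonempty, convex and compact, let f : ℝ^n → ℝ be convex, let G : ℝ^n → ℝ^n be continuous and monotone, let L > 0 and let D be the diameter of C. Define ψ^S(x) := sup{⟨G(x), x − y⟩ : y ∈ C}. Let (ε_k) be a sequence of positive reals with ε_k → 0 and let (x̃_k) be a sequence in C such that for every k: ψ^S(x̃_k) ≤ 2D√(Lε_k), and min{f(x) : x ∈ C, ψ^S(x) ≤ 2D√(Lε_k)} ≤ f(x̃_k) ≤ min{f(x) : x ∈ C, ψ^S(x) ≤ ε_k}. Then every cluster point x̄ of (x̃_k) satisfies ψ^S(x̄) ≤ 0 and f(x̄) ≤ f(x) for every x ∈ C with ψ^S(x) ≤ 0; that is, x̄ is an optimal solution of min{f(x) : x ∈ C, ψ^S(x) ≤ 0}. -/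

import Mathlib

open RealInnerProductSpace

/-- The Stampacchia gap function `ψ^S(x) = sup {⟪G x, x - y⟫ : y ∈ C}`. -/
noncomputable def psiS {n : ℕ} (G : EuclideanSpace ℝ (Fin n) → EuclideanSpace ℝ (Fin n))
    (C : Set (EuclideanSpace ℝ (Fin n))) (x : EuclideanSpace ℝ (Fin n)) : ℝ :=
  sSup ((fun y => ⟪G x, x - y⟫) '' C)

/-- Over a compact set, `psiS` bounds each of the values it is the supremum of. -/
theorem inner_le_psiS {n : ℕ} (G : EuclideanSpace ℝ (Fin n) → EuclideanSpace ℝ (Fin n))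
    {C : Set (EuclideanSpace ℝ (Fin n))} (hC : IsCompact C) (x : EuclideanSpace ℝ (Fin n))
    {y : EuclideanSpace ℝ (Fin n)} (hy : y ∈ C) : ⟪G x, x - y⟫ ≤ psiS G C x :=
  le_csSup (hC.image (by fun_prop)).bddAbove ⟨y, hy, rfl⟩

/-- If `ε_k ↓ 0` and the points `x̃ k ∈ C` satisfy
`ψ^S(x̃ k) ≤ 2 D √(L ε_k)` together with the value sandwich
`min {f : x ∈ C, ψ^S(x) ≤ 2 D √(L ε_k)} ≤ f(x̃ k) ≤ min {f : x ∈ C, ψ^S(x) ≤ ε_k}`,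
then every cluster point of `(x̃ k)` is an optimal solution of
`min {f(x) : x ∈ C, ψ^S(x) ≤ 0}`, i.e. of the bilevel problem (OPVI). -/
theorem cluster_points_of_sandwiched_sequence {n : ℕ} (C : Set (EuclideanSpace ℝ (Fin n)))
    (hne : C.Nonempty) (hconv : Convex ℝ C) (hcomp : IsCompact C)
    (f : EuclideanSpace ℝ (Fin n) → ℝ) (hf : ConvexOn ℝ Set.univ f)
    (G : EuclideanSpace ℝ (Fin n) → EuclideanSpace ℝ (Fin n))
    (hGc : Continuous G)
    (hGm : ∀ x y : EuclideanSpace ℝ (Fin n), 0 ≤ ⟪G x - G y, x - y⟫)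
    (L : ℝ) (hL : 0 < L) (D : ℝ) (hD : D = Metric.diam C)
    (ε : ℕ → ℝ) (hεpos : ∀ k, 0 < ε k) (hεlim : Filter.Tendsto ε Filter.atTop (nhds 0))
    (xt : ℕ → EuclideanSpace ℝ (Fin n)) (hxtC : ∀ k, xt k ∈ C)
    (hxtfeas : ∀ k, psiS G C (xt k) ≤ 2 * D * Real.sqrt (L * ε k))
    (hlow : ∀ k, sInf (f '' {x ∈ C | psiS G C x ≤ 2 * D * Real.sqrt (L * ε k)}) ≤ f (xt k))
    (hup : ∀ k, f (xt k) ≤ sInf (f '' {x ∈ C | psiS G C x ≤ ε k}))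
    (x' : EuclideanSpace ℝ (Fin n)) (hx' : MapClusterPt x' Filter.atTop xt) :
    x' ∈ C ∧ psiS G C x' ≤ 0 ∧ ∀ z ∈ C, psiS G C z ≤ 0 → f x' ≤ f z := by
  obtain ⟨φ, hφ, hlim⟩ := hx'.tendsto_subseq
  have hfc : Continuous f := hf.locallyLipschitz.continuous
  refine ⟨hcomp.isClosed.mem_of_tendsto hlim (.of_forall fun k => hxtC _), ?_, ?_⟩
  · refine csSup_le (hne.image _) ?_
    rintro _ ⟨y, hy, rfl⟩
    have hl : Filter.Tendsto (fun k => ⟪G (xt (φ k)), xt (φ k) - y⟫) Filter.atTop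
        (nhds ⟪G x', x' - y⟫) :=
      ((hGc.tendsto x').comp hlim).inner (hlim.sub_const y)
    have hr : Filter.Tendsto (fun k => 2 * D * Real.sqrt (L * ε (φ k))) Filter.atTop
        (nhds 0) := by
      simpa using (((hεlim.comp hφ.tendsto_atTop).const_mul L).sqrt).const_mul (2 * D)
    exact le_of_tendsto_of_tendsto' hl hr fun k =>
      (inner_le_psiS G hcomp _ hy).trans (hxtfeas _)
  · intro z hz hz0
    refine le_of_tendsto' ((hfc.tendsto x').comp hlim) fun k => (hup (φ k)).trans ?_
    exact csInf_le ((hcomp.image hfc).bddBelow.mono (Set.image_mono (Set.sep_subset _ _)))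
      ⟨z, ⟨hz, hz0.trans (hεpos _).le⟩, rfl⟩
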